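/- Let G be a finite simple graph, k a positive integer, and e an edge of G. If γ_{P,k}(G − e) = γ_{P,k}(G) − 1, then rad_{P,k}(G) ≤ rad_{P,k}(G − e), where G − e is the graph obtained from G by removing the edge e. -/

import Mathlib

open SimpleGraph

variable {V : Type*}

/-- The closed neighbourhood `N_G[v]` of a vertex. -/
def closedNbhd (G : SimpleGraph V) (v : V) : Set V := insert v (G.neighborSet v)

/-- The closed neighbourhood `N_G[X]` of a set of vertices. -/
def closedNbhdSet (G : SimpleGraph V) (X : Set V) : Set V := ⋃ v ∈ X, closedNbhd G v

/-- The sets `P^i_{G,k}(S)` of vertices monitored by `S` at step `i`. -/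
def monitored (G : SimpleGraph V) (k : ℕ) (S : Set V) : ℕ → Set V
  | 0 => closedNbhdSet G S
  | i + 1 =>
      ⋃ v ∈ {w | w ∈ monitored G k S i ∧ (closedNbhd G w \ monitored G k S i).ncard ≤ k},
        closedNbhd G v

/-- `S` is a `k`-power dominating set of `G`. -/
def IsPDS (G : SimpleGraph V) (k : ℕ) (S : Set V) : Prop :=
  ∃ i, monitored G k S i = Set.univ

/-- The `k`-power domination number `γ_{P,k}(G)`. -/
noncomputable def pdn (G : SimpleGraph V) (k : ℕ) : ℕ :=
  sInf {n | ∃ S : Set V, IsPDS G k S ∧ S.ncard = n}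

/-- The radius `rad_{P,k}(G,S)` of a `k`-PDS `S`. -/
noncomputable def radPDS (G : SimpleGraph V) (k : ℕ) (S : Set V) : ℕ :=
  1 + sInf {i | monitored G k S i = Set.univ}

/-- The `k`-propagation radius `rad_{P,k}(G)`. -/
noncomputable def propRad (G : SimpleGraph V) (k : ℕ) : ℕ :=
  sInf {r | ∃ S : Set V, IsPDS G k S ∧ S.ncard = pdn G k ∧ radPDS G k S = r}

lemma closedNbhd_mono {G H : SimpleGraph V} (h : H ≤ G) (v : V) :
    closedNbhd H v ⊆ closedNbhd G v :=
  Set.insert_subset_insert fun _ hw => h hw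

lemma closedNbhd_subset_closedNbhdSet (G : SimpleGraph V) {S : Set V} {v : V} (hv : v ∈ S) :
    closedNbhd G v ⊆ closedNbhdSet G S :=
  Set.subset_biUnion_of_mem (u := closedNbhd G) hv

/-- Everything dominated at step `0` stays monitored. -/
lemma closedNbhdSet_subset_monitored (G : SimpleGraph V) (k : ℕ) (S : Set V) (i : ℕ) :
    closedNbhdSet G S ⊆ monitored G k S i := by
  induction i with
  | zero => exact subset_rfl
  | succ i ih =>
    refine Set.iUnion₂_subset fun v hv => ?_
    have hN := (closedNbhd_subset_closedNbhdSet G hv).trans ih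
    refine Set.subset_biUnion_of_mem (u := closedNbhd G) ⟨hN (Set.mem_insert _ _), ?_⟩
    simp [Set.sdiff_eq_empty.mpr hN]

/-- If the neighbourhoods lost in passing from `G` to a subgraph `H` are dominated by `T ⊇ S`, then
`T` monitors `G` at least as fast as `S` monitors `H`. -/
lemma monitored_subset_monitored [Finite V] {G H : SimpleGraph V} (k : ℕ) {S T : Set V}
    (hHG : H ≤ G) (hST : S ⊆ T)
    (hT : ∀ v, closedNbhd G v ⊆ closedNbhd H v ∪ closedNbhdSet G T) (i : ℕ) :
    monitored H k S i ⊆ monitored G k T i := by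
  induction i with
  | zero =>
    exact Set.iUnion₂_subset fun v hv =>
      (closedNbhd_mono hHG v).trans (closedNbhd_subset_closedNbhdSet G (hST hv))
  | succ i ih =>
    refine Set.iUnion₂_subset fun v hv => (closedNbhd_mono hHG v).trans ?_
    refine Set.subset_biUnion_of_mem (u := closedNbhd G)
      ⟨ih hv.1, (Set.ncard_le_ncard ?_ (Set.toFinite _)).trans hv.2⟩
    rintro w ⟨hw, hwn⟩
    refine ⟨(hT v hw).resolve_right fun h => hwn ?_, fun h => hwn (ih h)⟩
    exact closedNbhdSet_subset_monitored G k T i h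

/-- Every neighbourhood lost by deleting an edge is dominated by either endpoint of that edge. -/
lemma closedNbhd_subset_deleteEdges_union {G : SimpleGraph V} {x y : V} (hxy : G.Adj x y)
    {T : Set V} (hx : x ∈ T) (v : V) :
    closedNbhd G v ⊆ closedNbhd (G.deleteEdges {s(x, y)}) v ∪ closedNbhdSet G T := by
  have hN := closedNbhd_subset_closedNbhdSet G hx
  rintro w (rfl | hw)
  · exact Or.inl (Set.mem_insert _ _)
  by_cases he : s(v, w) = s(x, y)
  · rcases Sym2.eq_iff.mp he with ⟨rfl, rfl⟩ | ⟨rfl, rfl⟩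
    · exact Or.inr (hN (Or.inr hxy))
    · exact Or.inr (hN (Set.mem_insert _ _))
  · exact Or.inl (Or.inr (deleteEdges_adj.mpr ⟨hw, he⟩))

lemma isPDS_univ (G : SimpleGraph V) (k : ℕ) : IsPDS G k Set.univ :=
  ⟨0, Set.eq_univ_of_forall fun v =>
    closedNbhd_subset_closedNbhdSet G (Set.mem_univ v) (Set.mem_insert _ _)⟩

lemma exists_isPDS_radPDS_eq_propRad (G : SimpleGraph V) (k : ℕ) :
    ∃ S : Set V, IsPDS G k S ∧ S.ncard = pdn G k ∧ radPDS G k S = propRad G k := by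
  obtain ⟨S, hS, hcard⟩ : ∃ S : Set V, IsPDS G k S ∧ S.ncard = pdn G k :=
    Nat.sInf_mem (s := {n | ∃ S : Set V, IsPDS G k S ∧ S.ncard = n}) ⟨_, _, isPDS_univ G k, rfl⟩
  exact Nat.sInf_mem
    (s := {r | ∃ S : Set V, IsPDS G k S ∧ S.ncard = pdn G k ∧ radPDS G k S = r})
    ⟨_, S, hS, hcard, rfl⟩

theorem propRad_edge_deletion_decrease {V : Type*} [Fintype V]
    (G : SimpleGraph V) (k : ℕ) (hk : 0 < k) (e : Sym2 V) (he : e ∈ G.edgeSet)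
    (h : pdn (G.deleteEdges {e}) k + 1 = pdn G k) :
    propRad G k ≤ propRad (G.deleteEdges {e}) k := by
  obtain ⟨S, hS, hcard, hrad⟩ := exists_isPDS_radPDS_eq_propRad (G.deleteEdges {e}) k
  induction e with | h x y => ?_
  have hsub := monitored_subset_monitored k (G.deleteEdges_le {s(x, y)}) (Set.subset_insert x S)
    (closedNbhd_subset_deleteEdges_union he (Set.mem_insert x S))
  have huniv : ∀ i, monitored (G.deleteEdges {s(x, y)}) k S i = Set.univ →
      monitored G k (insert x S) i = Set.univ :=
    fun i hi => Set.univ_subset_iff.mp (hi ▸ hsub i)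
  have hPDS : IsPDS G k (insert x S) := hS.imp huniv
  have hcard' : (insert x S).ncard = pdn G k := by
    refine le_antisymm ?_ (Nat.sInf_le ⟨_, hPDS, rfl⟩)
    rw [← h, ← hcard]
    exact Set.ncard_insert_le x S
  rw [← hrad]
  refine (Nat.sInf_le ⟨_, hPDS, hcard', rfl⟩ : propRad G k ≤ _).trans ?_
  exact Nat.add_le_add_left (Nat.sInf_le (huniv _ (Nat.sInf_mem hS))) 1
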